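/- Let 𝒳 and 𝒴 be normal G-automata. Then ⟦𝒳⟧ = ⟦𝒴⟧ if and only if the minimizations m(𝒳) and m(𝒴) are isomorphic as G-automata. -/

import Mathlib

open scoped Classical

/-- Guarded strings `GS = (At·Σ)*·At`, represented as a pair of a word in
`(At·Σ)*` (the guarded string without terminating atom) and a terminating atom. -/
abbrev GS (At Act : Type*) := List (At × Act) × At

variable {At Act X Y : Type*}

/-- Acceptance of a guarded string by a state of a `G`-coalgebra. -/
def GAccepts (δ : X → At → Bool ⊕ (Act × X)) : X → List (At × Act) → At → Prop
  | x, [], β => δ x β = Sum.inl true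
  | x, (α, p) :: w, β => ∃ y, δ x α = Sum.inr (p, y) ∧ GAccepts δ y w β

/-- The language `⟦x⟧ ⊆ GS` of a state of a `G`-coalgebra. -/
def glang (δ : X → At → Bool ⊕ (Act × X)) (x : X) : Set (GS At Act) :=
  {g | GAccepts δ x g.1 g.2}

/-- The transition relation `x →^w y` of a `G`-coalgebra. -/
inductive GReaches (δ : X → At → Bool ⊕ (Act × X)) : X → List (At × Act) → X → Prop
  | refl (x : X) : GReaches δ x [] x
  | single {x : X} {α : At} {p : Act} {y : X} :
      δ x α = Sum.inr (p, y) → GReaches δ x [(α, p)] y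
  | snoc {x y z : X} {v : List (At × Act)} {α : At} {p : Act} :
      GReaches δ x v y → δ y α = Sum.inr (p, z) → GReaches δ x (v ++ [(α, p)]) z

/-- The set `r(x)` of states reachable from `x`. -/
def grState (δ : X → At → Bool ⊕ (Act × X)) (x : X) : Set X :=
  {y | ∃ w, GReaches δ x w y}

/-- The set `R(x)` of words witnessing reachability from `x`. -/
def gRWords (δ : X → At → Bool ⊕ (Act × X)) (x : X) : Set (List (At × Act)) :=
  {w | ∃ y, GReaches δ x w y}

/-- A `G`-coalgebra is normal if it only transitions to live states. -/
def GNormal (δ : X → At → Bool ⊕ (Act × X)) : Prop :=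
  ∀ x α p y, δ x α = Sum.inr (p, y) → (glang δ y).Nonempty

/-- The derivative `w⁻¹L` of a guarded-string language. -/
def gderiv (w : List (At × Act)) (L : Set (GS At Act)) : Set (GS At Act) :=
  {u | (w ++ u.1, u.2) ∈ L}

/-- The transition map of the minimization `m(𝒳)` (defined on all of `Set GS`). -/
noncomputable def minDelta : Set (GS At Act) → At → Bool ⊕ (Act × Set (GS At Act)) :=
  fun L α =>
    if h : ∃ p : Act, (gderiv [(α, p)] L).Nonempty then
      Sum.inr (h.choose, gderiv [(α, h.choose)] L)
    else if (([], α) : GS At Act) ∈ L then Sum.inl true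
    else Sum.inl false

/-- The state space `{w⁻¹⟦𝒳⟧ | w ∈ R(x)}` of the minimization `m(𝒳)`. -/
def MinStates (δ : X → At → Bool ⊕ (Act × X)) (x : X) : Set (Set (GS At Act)) :=
  {L | ∃ w ∈ gRWords δ x, L = gderiv w (glang δ x)}

/-- Restriction of a `G`-coalgebra to an invariant subset of states. -/
def grestrict (δ : X → At → Bool ⊕ (Act × X)) (A : Set X)
    (hA : ∀ y ∈ A, ∀ (α : At) (p : Act) (z : X), δ y α = Sum.inr (p, z) → z ∈ A) :
    A → At → Bool ⊕ (Act × A) := fun y α =>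
  match h : δ y.val α with
  | Sum.inl b => Sum.inl b
  | Sum.inr (p, z) => Sum.inr (p, ⟨z, hA y.val y.2 α p z h⟩)

/-- Compatibility of two guarded strings: they agree on their first `n` actions
(or lack thereof) whenever they agree on their first `n` atoms. -/
def GCompat : List (At × Act) → At → List (At × Act) → At → Prop
  | [], _, [], _ => True
  | [], β, (α, _) :: _, _ => β ≠ α
  | (α, _) :: _, _, [], β => β ≠ α
  | (α, p) :: u, β, (α', p') :: u', β' => α = α' → p = p' ∧ GCompat u β u' β'

/-- A guarded-string language is deterministic if any two of its strings that agree
on their first `n` atoms also agree on their first `n` actions (or lack thereof). -/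
def GDetLang (L : Set (GS At Act)) : Prop :=
  ∀ u ∈ L, ∀ v ∈ L, GCompat u.1 u.2 v.1 v.2

/-- Bisimulations between `G`-coalgebras. -/
def IsGBisim (δX : X → At → Bool ⊕ (Act × X)) (δY : Y → At → Bool ⊕ (Act × Y))
    (R : X → Y → Prop) : Prop :=
  ∀ x y, R x y → ∀ α : At,
    (∀ b : Bool, δX x α = Sum.inl b → δY y α = Sum.inl b) ∧
    (∀ p x', δX x α = Sum.inr (p, x') → ∃ y', δY y α = Sum.inr (p, y') ∧ R x' y')

/-- Bisimilarity of states of `G`-coalgebras. -/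
def GBisimilar (δX : X → At → Bool ⊕ (Act × X)) (δY : Y → At → Bool ⊕ (Act × Y))
    (x : X) (y : Y) : Prop :=
  ∃ R, IsGBisim δX δY R ∧ R x y

/-- Simulations between `G`-coalgebras. -/
def IsGSim (δX : X → At → Bool ⊕ (Act × X)) (δY : Y → At → Bool ⊕ (Act × Y))
    (R : X → Y → Prop) : Prop :=
  ∀ x y, R x y → ∀ α : At,
    (δX x α = Sum.inl true → δY y α = Sum.inl true) ∧
    (∀ p x', δX x α = Sum.inr (p, x') → ∃ y', δY y α = Sum.inr (p, y') ∧ R x' y')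

/-- Similarity of states of `G`-coalgebras. -/
def GSimilar (δX : X → At → Bool ⊕ (Act × X)) (δY : Y → At → Bool ⊕ (Act × Y))
    (x : X) (y : Y) : Prop :=
  ∃ R, IsGSim δX δY R ∧ R x y

/-- Observation tables for the `GL*` algorithm. -/
structure ObsTable (At Act : Type*) where
  S : Set (List (At × Act))
  E : Set (GS At Act)
  row : List (At × Act) → Set (GS At Act)
  eps_mem : [] ∈ S
  atoms_mem : ∀ α : At, (([], α) : GS At Act) ∈ E
  prefix_closed : ∀ (s : List (At × Act)) (α : At) (p : Act), s ++ [(α, p)] ∈ S → s ∈ S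
  suffix_closed : ∀ (α : At) (p : Act) (e : GS At Act), (((α, p) :: e.1, e.2) : GS At Act) ∈ E → e ∈ E
  row_sub : ∀ t, row t ⊆ E
  rows_distinct : ∀ s ∈ S, ∀ t ∈ S, row s = row t → s = t
  row_nonempty : ∀ s ∈ S, s ≠ [] → (row s).Nonempty
  row_compat : ∀ s ∈ S, ∀ (α : At) (p : Act) (e : GS At Act),
      (((α, p) :: e.1, e.2) : GS At Act) ∈ E →
      (e ∈ row (s ++ [(α, p)]) ↔ (((α, p) :: e.1, e.2) : GS At Act) ∈ row s)

/-- A table is deterministic if all of its upper rows are deterministic languages. -/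
def ObsTable.Det (T : ObsTable At Act) : Prop := ∀ s ∈ T.S, GDetLang (T.row s)

/-- A table is closed if every nonzero lower row equals some upper row. -/
def ObsTable.Closed (T : ObsTable At Act) : Prop :=
  ∀ s ∈ T.S, ∀ (α : At) (p : Act), (T.row (s ++ [(α, p)])).Nonempty →
    ∃ t ∈ T.S, T.row t = T.row (s ++ [(α, p)])

/-- The transition map of the hypothesis automaton `m(T)` (defined on all of `Set GS`). -/
noncomputable def hypDelta (T : ObsTable At Act) :
    Set (GS At Act) → At → Bool ⊕ (Act × Set (GS At Act)) := fun L α =>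
  if h : ∃ s, s ∈ T.S ∧ T.row s = L then
    if hp : ∃ p : Act, (T.row (h.choose ++ [(α, p)])).Nonempty then
      Sum.inr (hp.choose, T.row (h.choose ++ [(α, hp.choose)]))
    else if (([], α) : GS At Act) ∈ L then Sum.inl true
    else Sum.inl false
  else Sum.inl false

/-- The state space `{row(s) | s ∈ S}` of the hypothesis automaton `m(T)`. -/
def HypStates (T : ObsTable At Act) : Set (Set (GS At Act)) := T.row '' T.S

/-- A `G`-automaton `(Y, δY, y)` is consistent with an observation table `T`. -/
def ConsistentWith (T : ObsTable At Act) (δY : Y → At → Bool ⊕ (Act × Y)) (y : Y) : Prop :=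
  T.S ⊆ gRWords δY y ∧
  ∀ s ∈ T.S, ∀ ys, GReaches δY y s ys → ∀ e ∈ T.E, (e ∈ glang δY ys ↔ e ∈ T.row s)

/-- Guarded-string suffixes of a guarded string (auxiliary version). -/
def gsufAux : List (At × Act) → At → Set (GS At Act)
  | [], β => {(([] : List (At × Act)), β)}
  | ap :: w, β => insert ((ap :: w, β) : GS At Act) (gsufAux w β)

/-- The set `suf(z)` of guarded-string suffixes of a guarded string `z`. -/
def gsuf (z : GS At Act) : Set (GS At Act) := gsufAux z.1 z.2

/-- Acceptance for Moore automata with input `At·Σ` and output `2^At`. -/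
def MAccepts (tr : Y → (At × Act) → Y) (out : Y → At → Bool) : Y → List (At × Act) → At → Prop
  | y, [], β => out y β = true
  | y, ap :: w, β => MAccepts tr out (tr y ap) w β

/-- The language of a state of a Moore automaton with input `At·Σ` and output `2^At`. -/
def mlang (tr : Y → (At × Act) → Y) (out : Y → At → Bool) (y : Y) : Set (GS At Act) :=
  {g | MAccepts tr out y g.1 g.2}

/-- Transition map of the Moore automaton `f(𝒳)` obtained from a `G`-automaton
by adding a sink state `⋆` (`= none`). -/
noncomputable def fTrans (δ : X → At → Bool ⊕ (Act × X)) : Option X → (At × Act) → Option X :=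
  fun s ap =>
    match s with
    | none => none
    | some y =>
      match δ y ap.1 with
      | Sum.inl _ => none
      | Sum.inr (q, z) => if q = ap.2 then some z else none

/-- Output map of the Moore automaton `f(𝒳)`. -/
noncomputable def fOut (δ : X → At → Bool ⊕ (Act × X)) : Option X → At → Bool :=
  fun s α =>
    match s with
    | none => false
    | some y => if δ y α = Sum.inl true then true else false

theorem GReaches.accepts_append_iff {δ : X → At → Bool ⊕ (Act × X)} {x z : X}
    {w : List (At × Act)} (h : GReaches δ x w z) (u : List (At × Act)) (β : At) :
    GAccepts δ x (w ++ u) β ↔ GAccepts δ z u β := by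
  induction h generalizing u with
  | refl => rfl
  | single h => simp [GAccepts, h]
  | snoc _ h ih => simp [ih, GAccepts, h]

theorem GReaches.gderiv_glang {δ : X → At → Bool ⊕ (Act × X)} {x z : X}
    {w : List (At × Act)} (h : GReaches δ x w z) : gderiv w (glang δ x) = glang δ z :=
  Set.ext fun u => h.accepts_append_iff u.1 u.2

theorem mem_gRWords_of_accepts {δ : X → At → Bool ⊕ (Act × X)} {x : X}
    (w u : List (At × Act)) (β : At) (h : GAccepts δ x (w ++ u) β) : w ∈ gRWords δ x := by
  induction w using List.reverseRecOn generalizing u with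
  | nil => exact ⟨x, .refl x⟩
  | append_singleton w ap ih =>
    rw [List.append_assoc] at h
    obtain ⟨z, hz⟩ := ih _ h
    obtain ⟨z', hz', -⟩ := (hz.accepts_append_iff _ _).1 h
    exact ⟨z', hz.snoc hz'⟩

/-- In a normal coalgebra, a nonempty word is a reachability witness iff the derivative along it
is nonempty. -/
theorem GNormal.mem_gRWords_iff {δ : X → At → Bool ⊕ (Act × X)} (hN : GNormal δ) {x : X}
    {w : List (At × Act)} :
    w ∈ gRWords δ x ↔ w = [] ∨ (gderiv w (glang δ x)).Nonempty := by
  constructor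
  · rintro ⟨z, hz⟩
    rw [hz.gderiv_glang]
    cases hz with
    | refl => exact .inl rfl
    | single h => exact .inr (hN _ _ _ _ h)
    | snoc _ h => exact .inr (hN _ _ _ _ h)
  · rintro (rfl | ⟨u, hu⟩)
    · exact ⟨x, .refl x⟩
    · exact mem_gRWords_of_accepts w u.1 u.2 hu

theorem minStates_eq_of_glang_eq {δX : X → At → Bool ⊕ (Act × X)}
    {δY : Y → At → Bool ⊕ (Act × Y)} (hNX : GNormal δX) (hNY : GNormal δY) {x : X} {y : Y}
    (h : glang δX x = glang δY y) : MinStates δX x = MinStates δY y := by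
  ext L
  simp only [MinStates, Set.mem_ofPred_eq, hNX.mem_gRWords_iff, hNY.mem_gRWords_iff, h]

theorem GReaches.glang_mem_minStates {δ : X → At → Bool ⊕ (Act × X)} {x z : X}
    {w : List (At × Act)} (h : GReaches δ x w z) : glang δ z ∈ MinStates δ x :=
  ⟨w, ⟨z, h⟩, h.gderiv_glang.symm⟩

theorem minDelta_glang_of_inl {δ : X → At → Bool ⊕ (Act × X)} {x : X} {α : At} {b : Bool}
    (h : δ x α = Sum.inl b) : minDelta (glang δ x) α = Sum.inl b := by
  have hd : ¬ ∃ p : Act, (gderiv [(α, p)] (glang δ x)).Nonempty := by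
    rintro ⟨p, u, z, hz, -⟩
    simp [h] at hz
  rw [minDelta, dif_neg hd]
  cases b <;> simp [glang, GAccepts, h]

theorem GNormal.minDelta_glang_of_inr {δ : X → At → Bool ⊕ (Act × X)} (hN : GNormal δ)
    {x z : X} {α : At} {p : Act} (h : δ x α = Sum.inr (p, z)) :
    minDelta (glang δ x) α = Sum.inr (p, glang δ z) := by
  have hr : gderiv [(α, p)] (glang δ x) = glang δ z := (GReaches.single h).gderiv_glang
  have hd : ∃ p : Act, (gderiv [(α, p)] (glang δ x)).Nonempty :=
    ⟨p, hr ▸ hN _ _ _ _ h⟩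
  have hp : hd.choose = p := by
    obtain ⟨u, z', hz', -⟩ := hd.choose_spec
    rw [h] at hz'
    exact (Prod.mk.inj (Sum.inr.inj hz')).1.symm
  rw [minDelta, dif_pos hd, hp, hr]

theorem IsGBisim.accepts_iff {δX : X → At → Bool ⊕ (Act × X)}
    {δY : Y → At → Bool ⊕ (Act × Y)} {R : X → Y → Prop} (hR : IsGBisim δX δY R)
    (w : List (At × Act)) (β : At) {x : X} {y : Y} (hxy : R x y) :
    GAccepts δX x w β ↔ GAccepts δY y w β := by
  induction w generalizing x y with
  | nil =>
    rcases h : δX x β with b | ⟨p, u⟩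
    · simp [GAccepts, h, (hR x y hxy β).1 b h]
    · obtain ⟨u', hu', -⟩ := (hR x y hxy β).2 p u h
      simp [GAccepts, h, hu']
  | cons ap w ih =>
    obtain ⟨α, p⟩ := ap
    rcases h : δX x α with b | ⟨q, u⟩
    · simp [GAccepts, h, (hR x y hxy α).1 b h]
    · obtain ⟨u', hu', huu'⟩ := (hR x y hxy α).2 q u h
      simp [GAccepts, h, hu', ih huu']

/-- A homomorphism between the minimizations of normal automata induces a bisimulation between
the automata themselves. -/
theorem isGBisim_of_minDelta_hom {δX : X → At → Bool ⊕ (Act × X)}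
    {δY : Y → At → Bool ⊕ (Act × Y)} (hNX : GNormal δX) (hNY : GNormal δY) {x : X}
    {f : Set (GS At Act) → Set (GS At Act)}
    (hf : ∀ L ∈ MinStates δX x, ∀ α : At,
      (∀ b : Bool, minDelta L α = Sum.inl b → minDelta (f L) α = Sum.inl b) ∧
      (∀ (p : Act) (L' : Set (GS At Act)), minDelta L α = Sum.inr (p, L') →
        minDelta (f L) α = Sum.inr (p, f L'))) :
    IsGBisim δX δY fun z z' => z ∈ grState δX x ∧ f (glang δX z) = glang δY z' := by
  rintro z z' ⟨⟨v, hz⟩, hzz'⟩ α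
  constructor
  · intro b h
    have hm := (hf _ hz.glang_mem_minStates α).1 b (minDelta_glang_of_inl h)
    rw [hzz'] at hm
    rcases h' : δY z' α with c | ⟨q, u'⟩
    · rw [minDelta_glang_of_inl h'] at hm
      rw [Sum.inl.inj hm]
    · simp [hNY.minDelta_glang_of_inr h'] at hm
  · intro p u h
    have hm := (hf _ hz.glang_mem_minStates α).2 p _ (hNX.minDelta_glang_of_inr h)
    rw [hzz'] at hm
    rcases h' : δY z' α with c | ⟨q, u'⟩
    · simp [minDelta_glang_of_inl h'] at hm
    · rw [hNY.minDelta_glang_of_inr h'] at hm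
      obtain ⟨rfl, hu⟩ := Prod.mk.inj (Sum.inr.inj hm)
      exact ⟨u', rfl, ⟨_, hz.snoc h⟩, hu.symm⟩

/-- two normal `G`-automata are language equivalent iff their minimizations
are isomorphic as `G`-automata. -/
theorem lang_eq_iff_min_iso {At Act : Type*} [Fintype At] [Nonempty At] [Fintype Act] [Nonempty Act] {X Y : Type*}
    (δX : X → At → Bool ⊕ (Act × X)) (x : X) (δY : Y → At → Bool ⊕ (Act × Y)) (y : Y)
    (hNX : GNormal δX) (hNY : GNormal δY) :
    glang δX x = glang δY y ↔
      ∃ f : Set (GS At Act) → Set (GS At Act),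
        Set.BijOn f (MinStates δX x) (MinStates δY y) ∧
        f (glang δX x) = glang δY y ∧
        ∀ L ∈ MinStates δX x, ∀ α : At,
          (∀ b : Bool, minDelta L α = Sum.inl b → minDelta (f L) α = Sum.inl b) ∧
          (∀ (p : Act) (L' : Set (GS At Act)), minDelta L α = Sum.inr (p, L') →
              minDelta (f L) α = Sum.inr (p, f L')) := by
  constructor
  · intro h
    refine ⟨id, ?_, h, fun L _ α => ⟨fun b hb => hb, fun p L' hL' => hL'⟩⟩
    rw [minStates_eq_of_glang_eq hNX hNY h]
    exact Set.bijOn_id _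
  · rintro ⟨f, -, hxy, hf⟩
    ext u
    exact (isGBisim_of_minDelta_hom hNX hNY hf).accepts_iff u.1 u.2 ⟨⟨[], .refl x⟩, hxy⟩
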